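/- arXiv:1108.2291 — 3 statements merged into one kernel-verified Lean document; each statement's English description precedes it below -/
import Mathlib

section
/- Fix a continuous function f : [0,1] → ℝ with f(0) > 0 and f(1) > 0, and let B be a standard Brownian bridge on [0,1]. Define the crossing event C = {∃ t ∈ (0,1) : B(t) > f(t)} and the touching event T = {∃ t ∈ (0,1) : B(t) = f(t)}. Then P(T ∩ Cᶜ) = 0; that is, almost surely B does not touch f without crossing it. -/
open MeasureTheory ProbabilityTheory
open scoped ENNReal NNReal

noncomputable section

/-- Covariance function of the standard Brownian bridge on `[0, T]`:
`E[B s * B t] = min s t * (T - max s t) / T`. -/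
def bridgeCov (T s t : ℝ) : ℝ := min s t * (T - max s t) / T

/-- `B` is a standard Brownian bridge on `[0, T]` under the probability measure `P`:
it has continuous sample paths on `[0, T]`, vanishes at `0` and `T`, and is a centered
Gaussian process with covariance `bridgeCov T`, in the sense that every finite linear
combination `∑ i, c i * B (ts i)` is a centered Gaussian with the corresponding variance. -/
def IsStdBridgeOn {Ω : Type*} [MeasurableSpace Ω] (P : Measure Ω) (T : ℝ)
    (B : Ω → ℝ → ℝ) : Prop :=
  (∀ ω, ContinuousOn (B ω) (Set.Icc 0 T)) ∧
  (∀ ω, B ω 0 = 0 ∧ B ω T = 0) ∧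
  (∀ s : ℝ, Measurable fun ω => B ω s) ∧
  ∀ (n : ℕ) (ts : Fin n → ℝ), (∀ i, ts i ∈ Set.Icc 0 T) → ∀ c : Fin n → ℝ,
    Measure.map (fun ω => ∑ i, c i * B ω (ts i)) P =
      gaussianReal 0 (∑ i, ∑ j, c i * c j * bridgeCov T (ts i) (ts j)).toNNReal

/-- The regression coefficient of `B s` on `B (1/2)`. -/
def bridgeReg (s : ℝ) : ℝ := 4 * (min s (1/2) * (1 - max s (1/2)))

lemma bridge_law_pair {Ω : Type*} [MeasurableSpace Ω] {P : Measure Ω}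
    {B : Ω → ℝ → ℝ} (hB : IsStdBridgeOn P 1 B) (s : ℝ) (hs : s ∈ Set.Icc (0:ℝ) 1) (a b : ℝ) :
    Measure.map (fun ω => a * B ω s + b * B ω (1/2)) P =
      gaussianReal 0 (a^2 * (s * (1 - s)) + a * b * bridgeReg s / 2 + b^2 / 4).toNNReal := by
  have h := hB.2.2.2 2 ![s, 1/2] (by
    intro i
    fin_cases i
    · exact hs
    · simp; norm_num) ![a, b]
  simp only [Fin.sum_univ_two, Matrix.cons_val_zero, Matrix.cons_val_one] at h
  rw [h]
  congr 2
  simp only [bridgeCov, bridgeReg, min_self, max_self, min_comm (1/2) s, max_comm (1/2) s]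
  ring

lemma bridge_var_pair {Ω : Type*} [MeasurableSpace Ω] {P : Measure Ω}
    {B : Ω → ℝ → ℝ} (hB : IsStdBridgeOn P 1 B) (s : ℝ) (hs : s ∈ Set.Icc (0:ℝ) 1) (a b : ℝ)
    (h0 : 0 ≤ a^2 * (s * (1 - s)) + a * b * bridgeReg s / 2 + b^2 / 4) :
    Var[fun ω => a * B ω s + b * B ω (1/2); P] =
      a^2 * (s * (1 - s)) + a * b * bridgeReg s / 2 + b^2 / 4 := by
  have hm := hB.2.2.1
  have hm' : Measurable (fun ω => a * B ω s + b * B ω (1/2)) :=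
    ((hm s).const_mul a).add ((hm (1/2)).const_mul b)
  rw [← variance_id_map hm'.aemeasurable, bridge_law_pair hB s hs, variance_id_gaussianReal,
    Real.coe_toNNReal _ h0]

lemma bridge_gaussian {Ω : Type*} [MeasurableSpace Ω] {P : Measure Ω}
    {B : Ω → ℝ → ℝ} (hB : IsStdBridgeOn P 1 B) :
    IsGaussianProcess (fun (t : Set.Icc (0:ℝ) 1) ω => B ω t) P where
  hasGaussianLaw I := by
    have hm := hB.2.2.1
    have hmr : Measurable (fun ω => I.restrict (fun t : Set.Icc (0:ℝ) 1 => B ω t)) :=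
      measurable_pi_lambda _ fun i => hm _
    constructor
    refine isGaussian_of_map_eq_gaussianReal fun L => ?_
    classical
    let e := I.equivFin.symm
    have h := hB.2.2.2 I.card (fun i => ((e i : Set.Icc (0:ℝ) 1) : ℝ)) (fun i => (e i).1.2)
      (fun i => L (Pi.single (e i) 1))
    refine ⟨0, (∑ i, ∑ j, L (Pi.single (e i) 1) * L (Pi.single (e j) 1) *
      bridgeCov 1 (e i : Set.Icc (0:ℝ) 1) (e j : Set.Icc (0:ℝ) 1)).toNNReal, ?_⟩
    · rw [Measure.map_map (by fun_prop) hmr, ← h]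
      congr 1
      ext ω
      rw [Function.comp_apply, ← L.sum_comp_single]
      rw [← e.sum_comp]
      refine Finset.sum_congr rfl fun i _ => ?_
      have : (Pi.single (e i) (I.restrict (fun t : Set.Icc (0:ℝ) 1 => B ω t) (e i)) : I → ℝ)
          = B ω (e i) • Pi.single (e i) 1 := by
        rw [← Pi.single_smul]; simp
      change L (Pi.single (e i) (I.restrict (fun t : Set.Icc (0:ℝ) 1 => B ω t) (e i))) = _
      rw [this, map_smul, smul_eq_mul, mul_comm]

lemma bridgeReg_eq (s : ℝ) : bridgeReg s = 2 * min s (1 - s) := by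
  unfold bridgeReg
  rcases le_total s (1/2) with h | h
  · rw [min_eq_left h, max_eq_right h, min_eq_left (by linarith)]; ring
  · rw [min_eq_right h, max_eq_left h, min_eq_right (by linarith)]; ring

lemma bridgeReg_sq (s : ℝ) (hs : s ∈ Set.Icc (0:ℝ) 1) : bridgeReg s ^ 2 / 4 ≤ s * (1 - s) := by
  rw [bridgeReg_eq]
  obtain ⟨h0, h1⟩ := hs
  rcases le_total s (1 - s) with h | h
  · rw [min_eq_left h]; nlinarith
  · rw [min_eq_right h]; nlinarith

lemma bridge_indep {Ω : Type*} [MeasurableSpace Ω] {P : Measure Ω}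
    {B : Ω → ℝ → ℝ} (hB : IsStdBridgeOn P 1 B) {S : Type*} (q : S → ℝ)
    (hq : ∀ s, q s ∈ Set.Icc (0:ℝ) 1) :
    IndepFun (fun ω s => B ω (q s) - bridgeReg (q s) * B ω (1/2))
      (fun ω (_ : Unit) => B ω (1/2)) P := by
  have hG := bridge_gaussian hB
  have := hG.isProbabilityMeasure
  have hm := hB.2.2.1
  have hhalf : (1/2 : ℝ) ∈ Set.Icc (0:ℝ) 1 := by constructor <;> norm_num
  refine IsGaussianProcess.indepFun_of_covariance_eq_zero
    (X := fun s ω => B ω (q s) - bridgeReg (q s) * B ω (1/2))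
    (Y := fun _ ω => B ω (1/2)) ?_ ?_ ?_ ?_
  · classical
    refine hG.of_isGaussianProcess fun s => ?_
    cases s with
    | inl s =>
      refine ⟨{⟨q s, hq s⟩, ⟨1/2, hhalf⟩},
        ContinuousLinearMap.proj (R := ℝ) ⟨⟨q s, hq s⟩, by simp⟩
          - bridgeReg (q s) • ContinuousLinearMap.proj (R := ℝ) ⟨⟨1/2, hhalf⟩, by simp⟩,
        fun ω => ?_⟩
      simp
    | inr s =>
      refine ⟨{⟨1/2, hhalf⟩},
        ContinuousLinearMap.proj (R := ℝ) ⟨⟨1/2, hhalf⟩, by simp⟩, fun ω => ?_⟩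
      simp
  · exact fun s => ((hm _).sub ((hm _).const_mul _)).aemeasurable
  · exact fun _ => (hm _).aemeasurable
  · intro s _
    have hL : ∀ t ∈ Set.Icc (0:ℝ) 1, MemLp (fun ω => B ω t) 2 P := fun t ht =>
      (hG.hasGaussianLaw_eval ⟨t, ht⟩).memLp_two
    have hY : MemLp (fun ω => B ω (q s) - bridgeReg (q s) * B ω (1/2)) 2 P :=
      (hL _ (hq s)).sub ((hL _ hhalf).const_mul _)
    have hadd := variance_fun_add hY (hL _ hhalf)
    have hsq := bridgeReg_sq (q s) (hq s)
    have e1 := bridge_var_pair hB (q s) (hq s) 1 (1 - bridgeReg (q s)) (by nlinarith)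
    have e2 := bridge_var_pair hB (q s) (hq s) 1 (- bridgeReg (q s)) (by nlinarith)
    have e3 := bridge_var_pair hB (q s) (hq s) 0 1 (by norm_num)
    have f1 : (fun ω => 1 * B ω (q s) + (1 - bridgeReg (q s)) * B ω (1/2)) =
        fun ω => B ω (q s) - bridgeReg (q s) * B ω (1/2) + B ω (1/2) := by
      ext; ring
    have f2 : (fun ω => 1 * B ω (q s) + (- bridgeReg (q s)) * B ω (1/2)) =
        fun ω => B ω (q s) - bridgeReg (q s) * B ω (1/2) := by
      ext; ring
    have f3 : (fun ω => 0 * B ω (q s) + 1 * B ω (1/2)) = fun ω => B ω (1/2) := by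
      ext; ring
    rw [f1] at e1
    rw [f2] at e2
    rw [f3] at e3
    rw [e1, e2, e3] at hadd
    nlinarith

/-- For every fixed residual path, at most one value of `z` makes the supremum equal to zero. -/
def touchSet {S : Type*} (g h : S → ℝ) : Set ((S → ℝ) × (Unit → ℝ)) :=
  {p | (∀ s, p.1 s + g s * p.2 () ≤ h s) ∧
    ∀ n : ℕ, ∃ s, h s - 1 / ((n : ℝ) + 1) < p.1 s + g s * p.2 ()}

lemma measurableSet_touchSet {S : Type*} [Countable S] (g h : S → ℝ) :
    MeasurableSet (touchSet g h) := by
  have hm : ∀ s, Measurable fun p : (S → ℝ) × (Unit → ℝ) => p.1 s + g s * p.2 () := fun s => by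
    fun_prop
  unfold touchSet
  simp only [Set.ofPred_and, Set.ofPred_forall, Set.ofPred_exists]
  refine MeasurableSet.inter ?_ ?_
  · exact MeasurableSet.iInter fun s => measurableSet_le (hm s) measurable_const
  · exact MeasurableSet.iInter fun n => MeasurableSet.iUnion fun s =>
      measurableSet_lt measurable_const (hm s)

lemma touchSet_not_lt {S : Type*} (g h : S → ℝ) {δ : ℝ} (hδ : 0 < δ) (hg : ∀ s, δ ≤ g s)
    (y : S → ℝ) (z z' : Unit → ℝ) (hz : (y, z) ∈ touchSet g h) (hz' : (y, z') ∈ touchSet g h) :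
    ¬ z () < z' () := by
  intro hlt
  obtain ⟨n, hn⟩ := exists_nat_one_div_lt (mul_pos hδ (sub_pos.2 hlt))
  obtain ⟨s, hs⟩ := hz.2 n
  have h1 := hz'.1 s
  have h2 := mul_le_mul_of_nonneg_right (hg s) (sub_pos.2 hlt).le
  simp only at hs h1
  nlinarith

lemma bridge_touch_null {Ω : Type*} [MeasurableSpace Ω] {P : Measure Ω} [IsProbabilityMeasure P]
    {B : Ω → ℝ → ℝ} (hB : IsStdBridgeOn P 1 B) {S : Type*} [Countable S] (q : S → ℝ)
    (hq : ∀ s, q s ∈ Set.Icc (0:ℝ) 1) {δ : ℝ} (hδ : 0 < δ) (hg : ∀ s, δ ≤ bridgeReg (q s))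
    (f : ℝ → ℝ) :
    P {ω | (∀ s, B ω (q s) ≤ f (q s)) ∧
      ∀ n : ℕ, ∃ s, f (q s) - 1 / ((n : ℝ) + 1) < B ω (q s)} = 0 := by
  have hm := hB.2.2.1
  have hind := bridge_indep hB q hq
  have hY : Measurable (fun ω s => B ω (q s) - bridgeReg (q s) * B ω (1/2)) :=
    measurable_pi_lambda _ fun s => (hm _).sub ((hm _).const_mul _)
  have hZ : Measurable (fun ω (_ : Unit) => B ω (1/2)) :=
    measurable_pi_lambda _ fun s => hm _
  have hD := measurableSet_touchSet (fun s => bridgeReg (q s)) (fun s => f (q s))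
  have hprod := (indepFun_iff_map_prod_eq_prod_map_map hY.aemeasurable hZ.aemeasurable).1 hind
  have hset : {ω | (∀ s, B ω (q s) ≤ f (q s)) ∧
      ∀ n : ℕ, ∃ s, f (q s) - 1 / ((n : ℝ) + 1) < B ω (q s)} =
      (fun ω => ((fun s => B ω (q s) - bridgeReg (q s) * B ω (1/2)),
        (fun (_ : Unit) => B ω (1/2)))) ⁻¹'
        touchSet (fun s => bridgeReg (q s)) (fun s => f (q s)) := by
    ext ω
    simp [touchSet]
  rw [hset, ← Measure.map_apply (hY.prodMk hZ) hD, hprod]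
  have := Measure.isProbabilityMeasure_map (μ := P) hZ.aemeasurable
  rw [Measure.measure_prod_null hD]
  refine Filter.Eventually.of_forall fun y => ?_
  simp only [Pi.zero_apply]
  have hsub : (Prod.mk y ⁻¹' touchSet (fun s => bridgeReg (q s)) (fun s => f (q s))).Subsingleton := by
    intro z hz z' hz'
    ext u
    rcases lt_trichotomy (z ()) (z' ()) with h | h | h
    · exact absurd h (touchSet_not_lt _ _ hδ hg y z z' hz hz')
    · exact h
    · exact absurd h (touchSet_not_lt _ _ hδ hg y z' z hz' hz)
  rcases hsub.eq_empty_or_singleton with h | ⟨z, h⟩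
  · rw [h]; simp
  · rw [h, Measure.map_apply hZ (measurableSet_singleton z)]
    have hlaw := bridge_law_pair hB 0 (by simp) 0 1
    have f3 : (fun ω => 0 * B ω 0 + 1 * B ω (1/2)) = fun ω => B ω (1/2) := by
      ext; ring
    rw [f3] at hlaw
    have hpre : ((fun ω (_ : Unit) => B ω (1/2)) ⁻¹' {z}) = (fun ω => B ω (1/2)) ⁻¹' {z ()} := by
      ext ω
      simp only [Set.mem_preimage, Set.mem_singleton_iff, funext_iff]
      exact ⟨fun hh => hh (), fun hh _ => hh⟩
    rw [hpre, ← Measure.map_apply (hm _) (measurableSet_singleton _), hlaw]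
    have : NullSingletonClass (gaussianReal 0
        ((0:ℝ)^2 * (0 * (1 - 0)) + 0 * 1 * bridgeReg 0 / 2 + 1^2 / 4).toNNReal) :=
      nullSingletonClass_gaussianReal (by simp)
    exact measure_singleton _

/-- **No touching without crossing.** Let `f : [0,1] → ℝ` be continuous with `f 0 > 0` and
`f 1 > 0`, and let `B` be a standard Brownian bridge on `[0,1]`. With `C` the crossing event
`{∃ t ∈ (0,1), B t > f t}` and `T` the touching event `{∃ t ∈ (0,1), B t = f t}`, we have
`P (T ∩ Cᶜ) = 0`. -/
theorem bridge_no_touch_without_crossing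
    {Ω : Type*} [MeasurableSpace Ω] (P : Measure Ω) (hP : IsProbabilityMeasure P)
    (B : Ω → ℝ → ℝ) (hB : IsStdBridgeOn P 1 B)
    (f : ℝ → ℝ) (hf : ContinuousOn f (Set.Icc 0 1)) (hf0 : 0 < f 0) (hf1 : 0 < f 1) :
    P ({ω | ∃ t ∈ Set.Ioo (0:ℝ) 1, B ω t = f t} ∩
        {ω | ∃ t ∈ Set.Ioo (0:ℝ) 1, f t < B ω t}ᶜ) = 0 := by
  have hc := hB.1
  let S : ℕ → Type := fun k => {r : ℚ // (r : ℝ) ∈ Set.Ioo (1 / ((k : ℝ) + 1)) (1 - 1 / ((k : ℝ) + 1))}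
  have hpos : ∀ k : ℕ, 0 < 1 / ((k : ℝ) + 1) := fun k => Nat.one_div_pos_of_nat
  have hnull : P (⋃ k : ℕ, {ω | (∀ s : S k, B ω (s.1 : ℝ) ≤ f (s.1 : ℝ)) ∧
      ∀ n : ℕ, ∃ s : S k, f (s.1 : ℝ) - 1 / ((n : ℝ) + 1) < B ω (s.1 : ℝ)}) = 0 := by
    refine measure_iUnion_null fun k => ?_
    have hk := hpos k
    refine bridge_touch_null hB (S := S k) (fun s => (s.1 : ℝ)) (fun s => ?_) hk (fun s => ?_) f
    · exact ⟨(hk.trans s.2.1).le, by have := s.2.2; linarith⟩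
    · have h1 := s.2.1
      have h2 := s.2.2
      rw [bridgeReg_eq]
      have : 1 / ((k : ℝ) + 1) ≤ min (s.1 : ℝ) (1 - s.1) := le_min h1.le (by linarith)
      linarith
  refine measure_mono_null ?_ hnull
  rintro ω ⟨⟨t, ht, hBt⟩, hC⟩
  have hC' : ∀ u ∈ Set.Ioo (0:ℝ) 1, B ω u ≤ f u := by
    intro u hu
    by_contra hlt
    exact hC ⟨u, hu, not_le.1 hlt⟩
  obtain ⟨k, hk⟩ := exists_nat_one_div_lt (lt_min ht.1 (sub_pos.2 ht.2))
  have hk1 := hk.trans_le (min_le_left _ _)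
  have hk2 := hk.trans_le (min_le_right _ _)
  have hkp := hpos k
  refine Set.mem_iUnion.2 ⟨k, fun s => ?_, fun n => ?_⟩
  · exact hC' _ ⟨hkp.trans s.2.1, by have := s.2.2; linarith⟩
  · have hcont : ContinuousAt (fun u => B ω u - f u) t :=
      ((hc ω).sub hf).continuousAt (Icc_mem_nhds ht.1 ht.2)
    have hev : ∀ᶠ u in nhds t, -(1 / ((n : ℝ) + 1)) < B ω u - f u :=
      hcont.eventually_const_lt (by simp only [hBt, sub_self]; linarith [hpos n])
    have hev2 : ∀ᶠ u in nhds t, u ∈ Set.Ioo (1 / ((k : ℝ) + 1)) (1 - 1 / ((k : ℝ) + 1)) :=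
      Ioo_mem_nhds hk1 (by linarith)
    obtain ⟨r, hr⟩ := Rat.denseRange_cast.mem_nhds (hev.and hev2)
    exact ⟨⟨r, hr.2⟩, by have := hr.1; simp only; linarith⟩
end
end

section
/- Consider the space of continuous functions from [0,1] to ℝ endowed with the uniform topology, and let U be an open subset which contains a function f with f(0) = f(1) = 0. Let B : [0,1] → ℝ be a standard Brownian bridge. Then P(the whole trajectory of B lies in U) > 0. -/
open MeasureTheory ProbabilityTheory
open scoped ENNReal NNReal

noncomputable section

namespace BridgeAux

lemma lin_law {Ω : Type*} [MeasurableSpace Ω] {P : Measure Ω}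
    {B : Ω → ℝ → ℝ} (hB : IsStdBridgeOn P 1 B) {ι : Type*} [Fintype ι]
    (ts : ι → ℝ) (hts : ∀ i, ts i ∈ Set.Icc (0:ℝ) 1) (c : ι → ℝ) :
    Measure.map (fun ω => ∑ i, c i * B ω (ts i)) P =
      gaussianReal 0 (∑ i, ∑ j, c i * c j * bridgeCov 1 (ts i) (ts j)).toNNReal := by
  let e := (Fintype.equivFin ι).symm
  have h := hB.2.2.2 _ (fun i => ts (e i)) (fun i => hts _) (fun i => c (e i))
  have h1 : (fun ω => ∑ i, c i * B ω (ts i)) =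
      fun ω => ∑ i, c (e i) * B ω (ts (e i)) := by
    funext ω
    exact (e.sum_comp (fun i => c i * B ω (ts i))).symm
  rw [h1, h]
  congr 2
  rw [← e.sum_comp]
  refine Finset.sum_congr rfl fun i _ => ?_
  rw [← e.sum_comp]

lemma dual_apply {ι : Type*} [Fintype ι] [DecidableEq ι] (L : (ι → ℝ) →L[ℝ] ℝ) (x : ι → ℝ) :
    L x = ∑ i, L (Pi.single i 1) * x i := by
  have := LinearMap.pi_apply_eq_sum_univ L.toLinearMap x
  simp only [ContinuousLinearMap.coe_coe, smul_eq_mul] at this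
  rw [this]
  refine Finset.sum_congr rfl fun i _ => ?_
  rw [mul_comm]
  congr 2
  funext j
  simp [Pi.single_apply, eq_comm]

lemma map_dual_law {Ω : Type*} [MeasurableSpace Ω] {P : Measure Ω}
    {B : Ω → ℝ → ℝ} (hB : IsStdBridgeOn P 1 B) {ι : Type*} [Fintype ι] [DecidableEq ι]
    (ts : ι → ℝ) (hts : ∀ i, ts i ∈ Set.Icc (0:ℝ) 1) (L : (ι → ℝ) →L[ℝ] ℝ) :
    Measure.map L (Measure.map (fun ω i => B ω (ts i)) P) =
      gaussianReal 0 (∑ i, ∑ j, L (Pi.single i 1) * L (Pi.single j 1)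
        * bridgeCov 1 (ts i) (ts j)).toNNReal := by
  rw [← lin_law hB ts hts, Measure.map_map (by fun_prop)
    (measurable_pi_lambda _ fun i => hB.2.2.1 _)]
  congr 1
  funext ω
  exact dual_apply L _

lemma bridge_gaussian {Ω : Type*} [MeasurableSpace Ω] {P : Measure Ω}
    {B : Ω → ℝ → ℝ} (hB : IsStdBridgeOn P 1 B) :
    IsGaussianProcess (fun (t : Set.Icc (0:ℝ) 1) ω => B ω t) P := by
  classical
  refine ⟨fun I => ⟨isGaussian_of_map_eq_gaussianReal fun L => ⟨_, _,
    map_dual_law hB (fun i : I => ((i : Set.Icc (0:ℝ) 1) : ℝ)) (fun i => i.1.2) L⟩⟩⟩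

lemma var_lin {Ω : Type*} [MeasurableSpace Ω] {P : Measure Ω}
    {B : Ω → ℝ → ℝ} (hB : IsStdBridgeOn P 1 B) {ι : Type*} [Fintype ι]
    (ts : ι → ℝ) (hts : ∀ i, ts i ∈ Set.Icc (0:ℝ) 1) (c : ι → ℝ) 
    (h0 : 0 ≤ ∑ i, ∑ j, c i * c j * bridgeCov 1 (ts i) (ts j)) :
    Var[fun ω => ∑ i, c i * B ω (ts i); P] =
      ∑ i, ∑ j, c i * c j * bridgeCov 1 (ts i) (ts j) := by
  have h := lin_law hB ts hts c
  have hm : Measurable (fun ω => ∑ i, c i * B ω (ts i)) :=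
    Finset.measurable_sum _ fun i _ => (hB.2.2.1 _).const_mul _
  rw [← variance_id_map hm.aemeasurable, h, variance_id_gaussianReal, Real.coe_toNNReal _ h0]

lemma bridgeCov_nonneg {s t : ℝ} (hs : s ∈ Set.Icc (0:ℝ) 1) (ht : t ∈ Set.Icc (0:ℝ) 1) :
    0 ≤ bridgeCov 1 s t := by
  unfold bridgeCov
  rw [div_one]
  exact mul_nonneg (le_min hs.1 ht.1) (sub_nonneg.2 (max_le hs.2 ht.2))

lemma bridgeCov_comm (s t : ℝ) : bridgeCov 1 s t = bridgeCov 1 t s := by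
  unfold bridgeCov
  rw [min_comm, max_comm]

lemma cov_eq {Ω : Type*} [MeasurableSpace Ω] {P : Measure Ω} [IsProbabilityMeasure P]
    {B : Ω → ℝ → ℝ} (hB : IsStdBridgeOn P 1 B) {s t : ℝ}
    (hs : s ∈ Set.Icc (0:ℝ) 1) (ht : t ∈ Set.Icc (0:ℝ) 1) :
    cov[fun ω => B ω s, fun ω => B ω t; P] = bridgeCov 1 s t := by
  have v1 : ∀ u ∈ Set.Icc (0:ℝ) 1, Var[fun ω => B ω u; P] = bridgeCov 1 u u := by
    intro u hu
    have := var_lin hB (fun _ : Unit => u) (fun _ => hu) (fun _ => 1)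
      (by simpa using bridgeCov_nonneg hu hu)
    simpa using this
  have ml : ∀ u ∈ Set.Icc (0:ℝ) 1, MemLp (fun ω => B ω u) 2 P := fun u hu =>
    ((bridge_gaussian hB).hasGaussianLaw_eval ⟨u, hu⟩).memLp_two
  have v2 := var_lin hB (![s, t]) (by intro i; fin_cases i <;> simp <;> assumption) (fun _ => 1)
      (by
        have := bridgeCov_nonneg hs hs
        have := bridgeCov_nonneg hs ht
        have := bridgeCov_nonneg ht hs
        have := bridgeCov_nonneg ht ht
        simp [Fin.sum_univ_two]; positivity)
  simp only [Fin.sum_univ_two, one_mul, Matrix.cons_val_zero, Matrix.cons_val_one] at v2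
  rw [variance_fun_add (ml s hs) (ml t ht), v1 s hs, v1 t ht, bridgeCov_comm t s] at v2
  linarith

lemma sum_ind {n i : ℕ} (hi : i ≤ n) :
    ∑ k : Fin n, (if (k : ℕ) < i then (1:ℝ) else 0) = i := by
  rw [Fin.sum_univ_eq_sum_range (fun k => if k < i then (1:ℝ) else 0) n]
  rw [← Finset.sum_filter]
  have : (Finset.range n).filter (· < i) = Finset.range i := by
    ext k; simp; omega
  rw [this]; simp

/-- coefficient matrix expressing the discrete bridge by independent increments. -/
def coefA (n : ℕ) (i : Fin (n + 1)) (k : Fin n) : ℝ :=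
  (if (k : ℕ) < (i : ℕ) then (1:ℝ) else 0) - (i : ℝ) / n

lemma coefA_sum (n : ℕ) (hn : 0 < n) (i j : Fin (n + 1)) :
    ∑ k, coefA n i k * coefA n j k / n = bridgeCov 1 ((i : ℝ) / n) ((j : ℝ) / n) := by
  have hn' : (n : ℝ) ≠ 0 := by positivity
  have h1 : ∀ k : Fin n, coefA n i k * coefA n j k / n =
      ((if (k : ℕ) < min (i : ℕ) j then (1:ℝ) else 0)
        - (j : ℝ) / n * (if (k : ℕ) < (i : ℕ) then (1:ℝ) else 0)
        - (i : ℝ) / n * (if (k : ℕ) < (j : ℕ) then (1:ℝ) else 0)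
        + (i : ℝ) / n * ((j : ℝ) / n)) / n := by
    intro k
    unfold coefA
    by_cases h1 : (k : ℕ) < (i : ℕ) <;> by_cases h2 : (k : ℕ) < (j : ℕ) <;>
      simp [h1, h2] <;> ring
  simp_rw [h1]
  rw [← Finset.sum_div, Finset.sum_add_distrib, Finset.sum_sub_distrib, Finset.sum_sub_distrib,
    ← Finset.mul_sum, ← Finset.mul_sum, sum_ind (by omega), sum_ind (by omega),
    sum_ind (by omega)]
  unfold bridgeCov
  have hpos : (0:ℝ) < n := by positivity
  rcases le_total (i : ℕ) (j : ℕ) with h | h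
  · have hr : (i : ℝ) / n ≤ (j : ℝ) / n := by gcongr
    rw [min_eq_left h, min_eq_left hr, max_eq_right hr]
    simp
    field_simp
    ring
  · have hr : (j : ℝ) / n ≤ (i : ℝ) / n := by gcongr
    rw [min_eq_right h, min_eq_right hr, max_eq_left hr]
    simp
    field_simp
    ring

/-- the linear map from increments to the discrete bridge. -/
def mapM (n : ℕ) : (Fin n → ℝ) →L[ℝ] (Fin (n + 1) → ℝ) :=
  ContinuousLinearMap.pi fun i => ∑ k, coefA n i k • ContinuousLinearMap.proj k

lemma mapM_apply (n : ℕ) (x : Fin n → ℝ) (i : Fin (n + 1)) :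
    mapM n x i = ∑ k, coefA n i k * x k := by
  simp [mapM]

lemma grid_mem {n : ℕ} (hn : 0 < n) (i : Fin (n + 1)) : (i : ℝ) / n ∈ Set.Icc (0:ℝ) 1 := by
  have hpos : (0:ℝ) < n := by positivity
  refine ⟨by positivity, ?_⟩
  rw [div_le_one hpos]
  exact_mod_cast Nat.lt_succ_iff.1 i.2

lemma law_grid {Ω : Type*} [MeasurableSpace Ω] {P : Measure Ω} [IsProbabilityMeasure P]
    {B : Ω → ℝ → ℝ} (hB : IsStdBridgeOn P 1 B) (n : ℕ) (hn : 0 < n) :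
    Measure.map (fun ω (i : Fin (n + 1)) => B ω ((i : ℝ) / n)) P =
      Measure.map (mapM n) (Measure.pi fun _ : Fin n => gaussianReal 0 (1 / n : ℝ≥0)) := by
  have hm : Measurable (fun ω (i : Fin (n + 1)) => B ω ((i : ℝ) / n)) :=
    measurable_pi_lambda _ fun i => hB.2.2.1 _
  have i1 := Measure.isProbabilityMeasure_map (μ := P) hm.aemeasurable
  have i2 := Measure.isProbabilityMeasure_map
    (μ := Measure.pi fun _ : Fin n => gaussianReal 0 (1 / n : ℝ≥0)) (f := mapM n)
    (by fun_prop)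
  refine Measure.ext_of_charFunDual (funext fun L => ?_)
  have key : ∑ i : Fin (n + 1), ∑ j : Fin (n + 1), L (Pi.single i 1) * L (Pi.single j 1)
        * bridgeCov 1 ((i : ℝ) / n) ((j : ℝ) / n)
        = ∑ k, (L (mapM n (Pi.single k 1))) ^ 2 / n := by
    have h1 : ∀ k, L (mapM n (Pi.single k 1)) = ∑ i, L (Pi.single i 1) * coefA n i k := by
      intro k
      rw [dual_apply L]
      refine Finset.sum_congr rfl fun i _ => ?_
      rw [mapM_apply]
      simp [Pi.single_apply]
    simp_rw [h1, ← coefA_sum n hn, pow_two, Finset.sum_mul_sum, Finset.sum_div, Finset.mul_sum]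
    rw [Finset.sum_comm' (t' := Finset.univ) (s' := fun _ => Finset.univ) (by simp)]
    rw [Finset.sum_comm]
    conv_rhs => rw [Finset.sum_comm]
    refine Finset.sum_congr rfl fun i _ => ?_
    rw [Finset.sum_comm]
    refine Finset.sum_congr rfl fun j _ => ?_
    refine Finset.sum_congr rfl fun k _ => ?_
    ring
  rw [charFunDual_eq_charFun_map_one, map_dual_law hB _ (grid_mem hn), charFun_gaussianReal,
    key, Real.coe_toNNReal _ (by positivity)]
  rw [charFunDual_map, charFunDual_pi]
  simp_rw [charFunDual_eq_charFun_map_one, gaussianReal_map_continuousLinearMap,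
    charFun_gaussianReal]
  rw [← Complex.exp_sum]
  congr 1
  simp [Finset.sum_div]
  refine Finset.sum_congr rfl fun k _ => ?_
  rw [max_eq_left (sq_nonneg _)]
  push_cast
  rw [div_eq_mul_inv _ (n : ℂ)]

lemma grid_pos {Ω : Type*} [MeasurableSpace Ω] {P : Measure Ω} [IsProbabilityMeasure P]
    {B : Ω → ℝ → ℝ} (hB : IsStdBridgeOn P 1 B) (n : ℕ) (hn : 0 < n)
    (y : ℕ → ℝ) (y0 : y 0 = 0) (yn : y n = 0) (ε : ℝ) (hε : 0 < ε) :
    0 < P {ω | ∀ i : Fin (n + 1), |B ω ((i : ℝ) / n) - y i| < ε} := by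
  have hm : Measurable (fun ω (i : Fin (n + 1)) => B ω ((i : ℝ) / n)) :=
    measurable_pi_lambda _ fun i => hB.2.2.1 _
  let V : Set (Fin (n + 1) → ℝ) := {z | ∀ i, |z i - y i| < ε}
  have hV : IsOpen V := by
    have : V = ⋂ i : Fin (n + 1), {z : Fin (n + 1) → ℝ | |z i - y i| < ε} := by ext; simp [V]
    rw [this]
    refine isOpen_iInter_of_finite fun i => ?_
    exact isOpen_lt (by fun_prop) continuous_const
  have h1 : P {ω | ∀ i : Fin (n + 1), |B ω ((i : ℝ) / n) - y i| < ε} =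
      Measure.map (fun ω (i : Fin (n + 1)) => B ω ((i : ℝ) / n)) P V := by
    rw [Measure.map_apply hm hV.measurableSet]; rfl
  have hv : (1 / n : ℝ≥0) ≠ 0 := by positivity
  have : (gaussianReal 0 (1 / n : ℝ≥0)).IsOpenPosMeasure :=
    (gaussianReal_absolutelyContinuous' 0 hv).isOpenPosMeasure
  rw [h1, law_grid hB n hn, Measure.map_apply (by fun_prop) hV.measurableSet]
  refine (hV.preimage (mapM n).continuous).measure_pos _ ?_
  refine ⟨fun k => y (k + 1) - y k, fun i => ?_⟩
  have h2 : mapM n (fun k => y (k + 1) - y k) i = y i := by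
    rw [mapM_apply]
    simp_rw [coefA, sub_mul, Finset.sum_sub_distrib, ← Finset.mul_sum]
    rw [Fin.sum_univ_eq_sum_range (fun k => y (k + 1) - y k) n, Finset.sum_range_sub, y0, yn]
    rw [Fin.sum_univ_eq_sum_range
      (fun k => (if k < (i : ℕ) then (1:ℝ) else 0) * (y (k + 1) - y k)) n]
    simp_rw [ite_mul, one_mul, zero_mul]
    rw [← Finset.sum_filter]
    have : (Finset.range n).filter (· < (i : ℕ)) = Finset.range i := by
      ext k; simp; omega
    rw [this, Finset.sum_range_sub, y0]
    simp
  simp only [h2]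
  simpa using hε

/-- residual of the linear interpolation on the `k`-th grid cell. -/
def resid (n : ℕ) (g : ℝ → ℝ) (k : ℕ) (u : ℝ) : ℝ :=
  g (((k : ℝ) + u) / n) - (1 - u) * g ((k : ℝ) / n) - u * g (((k + 1 : ℕ) : ℝ) / n)

lemma cell_mem {n k : ℕ} (hk : k < n) {u : ℝ} (hu : u ∈ Set.Icc (0:ℝ) 1) :
    ((k : ℝ) + u) / n ∈ Set.Icc (0:ℝ) 1 := by
  have hpos : (0:ℝ) < n := by exact_mod_cast (by omega : 0 < n)
  have : (k : ℝ) + 1 ≤ n := by exact_mod_cast hk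
  have h0 := hu.1
  have h1 := hu.2
  refine ⟨by positivity, ?_⟩
  rw [div_le_one hpos]
  linarith

lemma grid_mem' {n k : ℕ} (hn : 0 < n) (hk : k ≤ n) : (k : ℝ) / n ∈ Set.Icc (0:ℝ) 1 :=
  grid_mem hn ⟨k, by omega⟩

lemma bridgeCov_resid {n k j : ℕ} (hk : k < n) {u : ℝ} (hu : u ∈ Set.Icc (0:ℝ) 1) :
    bridgeCov 1 (((k : ℝ) + u) / n) ((j : ℝ) / n) - (1 - u) * bridgeCov 1 ((k : ℝ) / n) ((j : ℝ) / n)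
      - u * bridgeCov 1 (((k + 1 : ℕ) : ℝ) / n) ((j : ℝ) / n) = 0 := by
  have hpos : (0:ℝ) < n := by exact_mod_cast (by omega : 0 < n)
  have h0 := hu.1
  have h1 := hu.2
  unfold bridgeCov
  rcases Nat.lt_or_ge k j with h | h
  · have h' : (k : ℝ) + 1 ≤ j := by exact_mod_cast h
    have e1 : ((k : ℝ) + u) / n ≤ (j : ℝ) / n := by gcongr; linarith
    have e2 : (k : ℝ) / n ≤ (j : ℝ) / n := by gcongr
    have e3 : ((k + 1 : ℕ) : ℝ) / n ≤ (j : ℝ) / n := by gcongr; exact_mod_cast h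
    rw [min_eq_left e1, min_eq_left e2, min_eq_left e3, max_eq_right e1, max_eq_right e2,
      max_eq_right e3]
    push_cast
    ring
  · have h' : (j : ℝ) ≤ k := by exact_mod_cast h
    have e1 : (j : ℝ) / n ≤ ((k : ℝ) + u) / n := by gcongr; linarith
    have e2 : (j : ℝ) / n ≤ (k : ℝ) / n := by gcongr
    have e3 : (j : ℝ) / n ≤ ((k + 1 : ℕ) : ℝ) / n := by gcongr; linarith
    rw [min_eq_right e1, min_eq_right e2, min_eq_right e3, max_eq_left e1, max_eq_left e2,
      max_eq_left e3]
    push_cast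
    ring

lemma indep {Ω : Type*} [MeasurableSpace Ω] {P : Measure Ω} [IsProbabilityMeasure P]
    {B : Ω → ℝ → ℝ} (hB : IsStdBridgeOn P 1 B) (n : ℕ) (hn : 0 < n)
    (d : ℕ → Set.Icc (0:ℝ) 1) :
    IndepFun (fun ω (p : Fin n × ℕ) => resid n (B ω) p.1 (d p.2))
      (fun ω (i : Fin (n + 1)) => B ω ((i : ℝ) / n)) P := by
  classical
  have hG := bridge_gaussian hB
  have ml : ∀ u ∈ Set.Icc (0:ℝ) 1, MemLp (fun ω => B ω u) 2 P := fun u hu =>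
    (hG.hasGaussianLaw_eval ⟨u, hu⟩).memLp_two
  have mB := hB.2.2.1
  refine IsGaussianProcess.indepFun_of_covariance_eq_zero
    (X := fun (p : Fin n × ℕ) ω => resid n (B ω) p.1 (d p.2))
    (Y := fun (i : Fin (n + 1)) ω => B ω ((i : ℝ) / n)) ?_ ?_ ?_ ?_
  · refine hG.of_isGaussianProcess ?_
    rintro (⟨k, m⟩ | i)
    · let a : Set.Icc (0:ℝ) 1 := ⟨_, cell_mem k.2 (d m).2⟩
      let b : Set.Icc (0:ℝ) 1 := ⟨_, grid_mem' hn k.2.le⟩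
      let c : Set.Icc (0:ℝ) 1 := ⟨_, grid_mem' hn k.2⟩
      let I : Finset (Set.Icc (0:ℝ) 1) := {a, b, c}
      have ha : a ∈ I := by simp [I]
      have hb : b ∈ I := by simp [I]
      have hc : c ∈ I := by simp [I]
      refine ⟨I, ContinuousLinearMap.proj (⟨a, ha⟩ : I)
        - (1 - (d m : ℝ)) • ContinuousLinearMap.proj (⟨b, hb⟩ : I)
        - (d m : ℝ) • ContinuousLinearMap.proj (⟨c, hc⟩ : I), fun ω => ?_⟩
      simp [resid, a, b, c]
    · let a : Set.Icc (0:ℝ) 1 := ⟨_, grid_mem hn i⟩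
      exact ⟨{a}, ContinuousLinearMap.proj ⟨a, by simp⟩, fun ω => by simp [a]⟩
  · intro p
    unfold resid
    exact (((mB _).sub ((mB _).const_mul _)).sub ((mB _).const_mul _)).aemeasurable
  · intro i
    exact (mB _).aemeasurable
  · rintro ⟨k, m⟩ i
    have m1 := ml _ (cell_mem k.2 (d m).2)
    have m2 := ml _ (grid_mem' hn k.2.le)
    have m3 := ml _ (grid_mem' hn k.2)
    have m4 := ml _ (grid_mem hn i)
    have m12 : MemLp (fun ω => B ω (((k : ℕ) + (d m : ℝ)) / n)
        - (1 - (d m : ℝ)) * B ω (((k : ℕ) : ℝ) / n)) 2 P := m1.sub (m2.const_mul _)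
    have m3' : MemLp (fun ω => (d m : ℝ) * B ω ((((k : ℕ) + 1 : ℕ) : ℝ) / n)) 2 P :=
      m3.const_mul _
    have m2' : MemLp (fun ω => (1 - (d m : ℝ)) * B ω (((k : ℕ) : ℝ) / n)) 2 P :=
      m2.const_mul _
    unfold resid
    dsimp only
    rw [covariance_fun_sub_left m12 m3' m4,
      covariance_fun_sub_left m1 m2' m4,
      covariance_const_mul_left, covariance_const_mul_left,
      cov_eq hB (cell_mem k.2 (d m).2) (grid_mem hn i),
      cov_eq hB (grid_mem' hn k.2.le) (grid_mem hn i),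
      cov_eq hB (grid_mem' hn k.2) (grid_mem hn i)]
    exact bridgeCov_resid k.2 (d m).2

/-- uniform continuity on cells makes the residuals small. -/
lemma resid_small {g : ℝ → ℝ} (hg : ContinuousOn g (Set.Icc 0 1)) {ε : ℝ} (hε : 0 < ε) :
    ∃ N : ℕ, 0 < N ∧ ∀ n ≥ N, ∀ k < n, ∀ u ∈ Set.Icc (0:ℝ) 1, |resid n g k u| ≤ ε := by
  have huc := isCompact_Icc.uniformContinuousOn_of_continuous hg
  rw [Metric.uniformContinuousOn_iff] at huc
  obtain ⟨δ, hδ, H⟩ := huc ε hε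
  obtain ⟨N, hN⟩ := exists_nat_gt (1 / δ)
  refine ⟨N + 1, by omega, fun n hn k hk u hu => ?_⟩
  have hn0 : 0 < n := by omega
  have hpos : (0:ℝ) < n := by positivity
  have hnd : 1 / (n : ℝ) < δ := by
    rw [div_lt_comm₀ hpos hδ]
    have : ((N + 1 : ℕ) : ℝ) ≤ n := by exact_mod_cast hn
    push_cast at this
    linarith
  have h0 := hu.1
  have h1 := hu.2
  have a1 := H _ (cell_mem hk hu) _ (grid_mem' hn0 hk.le) (by
    rw [Real.dist_eq, ← sub_div, abs_div, abs_of_pos hpos]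
    refine lt_of_le_of_lt ?_ hnd
    gcongr
    rw [abs_le]; constructor <;> linarith)
  have a2 := H _ (cell_mem hk hu) _ (grid_mem' hn0 hk) (by
    rw [Real.dist_eq, ← sub_div, abs_div, abs_of_pos hpos]
    refine lt_of_le_of_lt ?_ hnd
    gcongr
    push_cast
    rw [abs_le]; constructor <;> linarith)
  rw [Real.dist_eq, abs_lt] at a1 a2
  have e : resid n g k u = (1 - u) * (g (((k : ℝ) + u) / n) - g ((k : ℝ) / n))
      + u * (g (((k : ℝ) + u) / n) - g (((k + 1 : ℕ) : ℝ) / n)) := by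
    unfold resid; ring
  rw [e, abs_le]
  constructor <;> nlinarith

lemma exists_cell {n : ℕ} (hn : 0 < n) {t : ℝ} (ht : t ∈ Set.Icc (0:ℝ) 1) :
    ∃ k < n, ∃ u ∈ Set.Icc (0:ℝ) 1, t = ((k : ℝ) + u) / n := by
  have hpos : (0:ℝ) < n := by positivity
  rcases eq_or_lt_of_le ht.2 with h | h
  · refine ⟨n - 1, by omega, 1, by simp, ?_⟩
    rw [Nat.cast_sub (by omega)]
    simp [h, hpos.ne']
  · have h0 : 0 ≤ t * n := mul_nonneg ht.1 hpos.le
    refine ⟨⌊t * n⌋₊, ?_, t * n - ⌊t * n⌋₊, ⟨?_, ?_⟩, ?_⟩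
    · rw [Nat.floor_lt h0]
      nlinarith
    · linarith [Nat.floor_le h0]
    · linarith [Nat.lt_floor_add_one (t * n)]
    · field_simp
      ring

lemma close_of {n : ℕ} (hn : 0 < n) {g h : ℝ → ℝ} {ε : ℝ}
    (hg : ∀ k < n, ∀ u ∈ Set.Icc (0:ℝ) 1, |resid n g k u| ≤ ε)
    (hh : ∀ k < n, ∀ u ∈ Set.Icc (0:ℝ) 1, |resid n h k u| ≤ ε)
    (hgh : ∀ i : Fin (n + 1), |g ((i : ℝ) / n) - h ((i : ℝ) / n)| < ε)
    {t : ℝ} (ht : t ∈ Set.Icc (0:ℝ) 1) : |g t - h t| ≤ 3 * ε := by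
  obtain ⟨k, hk, u, hu, rfl⟩ := exists_cell hn ht
  have a1 := abs_le.1 (hg k hk u hu)
  have a2 := abs_le.1 (hh k hk u hu)
  have a3 := abs_lt.1 (hgh ⟨k, by omega⟩)
  have a4 := abs_lt.1 (hgh ⟨k + 1, by omega⟩)
  have h0 := hu.1
  have h1 := hu.2
  unfold resid at a1 a2
  simp only at a3 a4
  set x1 := g ((k : ℝ) / n)
  set x2 := h ((k : ℝ) / n)
  set y1 := g (((k + 1 : ℕ) : ℝ) / n)
  set y2 := h (((k + 1 : ℕ) : ℝ) / n)
  have b1 : (1 - u) * (x1 - x2) + u * (y1 - y2) ≤ ε := by nlinarith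
  have b2 : -ε ≤ (1 - u) * (x1 - x2) + u * (y1 - y2) := by nlinarith
  rw [abs_le]
  constructor <;> nlinarith

lemma resid_dense {n k : ℕ} (hk : k < n) {g : ℝ → ℝ} (hg : ContinuousOn g (Set.Icc 0 1))
    {d : ℕ → Set.Icc (0:ℝ) 1} (hd : DenseRange d) {ε : ℝ}
    (h : ∀ m, |resid n g k (d m)| ≤ ε) : ∀ u ∈ Set.Icc (0:ℝ) 1, |resid n g k u| ≤ ε := by
  have hc : Continuous fun u : Set.Icc (0:ℝ) 1 => |resid n g k u| := by
    have h1 : Continuous fun u : Set.Icc (0:ℝ) 1 => g (((k : ℝ) + u) / n) :=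
      hg.comp_continuous (by fun_prop) fun u => cell_mem hk u.2
    unfold resid
    exact ((h1.sub (by fun_prop)).sub (by fun_prop)).abs
  have hcl : IsClosed {u : Set.Icc (0:ℝ) 1 | |resid n g k u| ≤ ε} :=
    isClosed_le hc continuous_const
  intro u hu
  exact hd.induction_on (p := fun u : Set.Icc (0:ℝ) 1 => |resid n g k u| ≤ ε) ⟨u, hu⟩ hcl h

end BridgeAux

/-- **Open sets of paths have positive probability.** Let `U` be an open subset of the space
`C([0,1], ℝ)` of continuous functions with the uniform topology, containing some `f` with
`f 0 = f 1 = 0`. If `B` is a standard Brownian bridge on `[0,1]`, then with positive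
probability the trajectory of `B` on `[0,1]` lies in `U`. -/
theorem bridge_hits_open_set
    {Ω : Type*} [MeasurableSpace Ω] (P : Measure Ω) (hP : IsProbabilityMeasure P)
    (B : Ω → ℝ → ℝ) (hB : IsStdBridgeOn P 1 B)
    (U : Set C(Set.Icc (0:ℝ) 1, ℝ)) (hU : IsOpen U)
    (f : C(Set.Icc (0:ℝ) 1, ℝ)) (hfU : f ∈ U)
    (hf0 : f ⟨0, Set.mem_Icc.mpr (by norm_num)⟩ = 0)
    (hf1 : f ⟨1, Set.mem_Icc.mpr (by norm_num)⟩ = 0) :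
    0 < P {ω | ∃ g : C(Set.Icc (0:ℝ) 1, ℝ),
        (∀ s : Set.Icc (0:ℝ) 1, g s = B ω (s : ℝ)) ∧ g ∈ U} := by
  classical
  obtain ⟨δ, hδ, hball⟩ := Metric.isOpen_iff.1 hU f hfU
  set ε : ℝ := δ / 4 with hεdef
  have hε : 0 < ε := by positivity
  let F : ℝ → ℝ := Set.IccExtend (zero_le_one' ℝ) f
  have hF : ContinuousOn F (Set.Icc 0 1) := f.continuous.Icc_extend'.continuousOn
  have hFeq : ∀ t (ht : t ∈ Set.Icc (0:ℝ) 1), F t = f ⟨t, ht⟩ := fun t ht =>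
    Set.IccExtend_of_mem _ _ ht
  have hF0 : F 0 = 0 := by rw [hFeq 0 (by simp)]; exact hf0
  have hF1 : F 1 = 0 := by rw [hFeq 1 (by simp)]; exact hf1
  let d := TopologicalSpace.denseSeq (Set.Icc (0:ℝ) 1)
  have hd : DenseRange d := TopologicalSpace.denseRange_denseSeq _
  obtain ⟨N, hN, hNF⟩ := BridgeAux.resid_small hF hε
  let E : ℕ → Set Ω := fun n =>
    {ω | ∀ k < n, ∀ u ∈ Set.Icc (0:ℝ) 1, |BridgeAux.resid n (B ω) k u| ≤ ε}
  have hE : ∃ n ≥ N, 0 < P (E n) := by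
    by_contra hcon
    push Not at hcon
    have hun : P (⋃ n, E (n + N)) = 0 :=
      measure_iUnion_null fun n => le_antisymm (hcon (n + N) (by omega)) zero_le
    have huniv : (⋃ n, E (n + N)) = Set.univ := by
      refine Set.eq_univ_of_forall fun ω => ?_
      obtain ⟨M, _, hM⟩ := BridgeAux.resid_small (hB.1 ω) hε
      exact Set.mem_iUnion.2 ⟨M, hM _ (by omega)⟩
    rw [huniv, measure_univ] at hun
    exact one_ne_zero hun
  obtain ⟨n, hnN, hEn⟩ := hE
  have hn : 0 < n := by omega
  have hn' : (n : ℝ) ≠ 0 := by positivity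
  have hgrid := BridgeAux.grid_pos hB n hn (fun i => F ((i : ℝ) / n)) (by simpa using hF0)
    (by simpa [hn'] using hF1) ε hε
  have hind := BridgeAux.indep hB n hn d
  let S : Set (Fin n × ℕ → ℝ) := {z | ∀ p, |z p| ≤ ε}
  let T : Set (Fin (n + 1) → ℝ) := {z | ∀ i, |z i - F ((i : ℝ) / n)| < ε}
  have hS : MeasurableSet S := by
    have : S = ⋂ p, {z : Fin n × ℕ → ℝ | |z p| ≤ ε} := by ext; simp [S]
    rw [this]
    exact MeasurableSet.iInter fun p =>
      measurableSet_le (measurable_pi_apply p).abs measurable_const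
  have hT : MeasurableSet T := by
    have : T = ⋂ i : Fin (n + 1), {z : Fin (n + 1) → ℝ | |z i - F ((i : ℝ) / n)| < ε} := by
      ext; simp [T]
    rw [this]
    exact MeasurableSet.iInter fun i =>
      measurableSet_lt ((measurable_pi_apply i).sub_const _).abs measurable_const
  have hprod := hind.measure_inter_preimage_eq_mul S T hS hT
  have h1 : 0 < P ((fun ω (p : Fin n × ℕ) => BridgeAux.resid n (B ω) p.1 (d p.2)) ⁻¹' S) :=
    lt_of_lt_of_le hEn (measure_mono fun ω hω p => hω p.1 p.1.2 _ (d p.2).2)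
  have h2 : 0 < P ((fun ω (i : Fin (n + 1)) => B ω ((i : ℝ) / n)) ⁻¹' T) := hgrid
  refine lt_of_lt_of_le (hprod ▸ ENNReal.mul_pos h1.ne' h2.ne') (measure_mono ?_)
  rintro ω ⟨hω1, hω2⟩
  have hres : ∀ k < n, ∀ u ∈ Set.Icc (0:ℝ) 1, |BridgeAux.resid n (B ω) k u| ≤ ε :=
    fun k hk => BridgeAux.resid_dense hk (hB.1 ω) hd fun m => hω1 (⟨k, hk⟩, m)
  refine ⟨⟨fun s => B ω s, continuousOn_iff_continuous_domRestrict.1 (hB.1 ω)⟩, fun s => rfl,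
    hball ?_⟩
  rw [Metric.mem_ball, ContinuousMap.dist_lt_iff hδ]
  intro s
  have := BridgeAux.close_of hn hres (hNF n hnN) hω2 s.2
  rw [hFeq s s.2] at this
  rw [Real.dist_eq]
  refine lt_of_le_of_lt this ?_
  rw [hεdef]
  linarith
end
end

section
/- Let M, δ > 0 and let B : [0,1] → ℝ be a Brownian bridge on [0,1] from B(0) = δ to B(1) = M. Then P(B(s) > 0 for all s ∈ [0,1]) ≤ 4 (2/π)^{1/2} (δM)^{1/2}. -/
open MeasureTheory ProbabilityTheory
open scoped ENNReal NNReal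

noncomputable section

/-- `B` is a Brownian bridge on `[a, b]` from `x` to `y` (diffusion parameter 1) under `P`:
subtracting the affine interpolation between `(a, x)` and `(b, y)` and shifting time by `a`
yields a standard Brownian bridge on `[0, b - a]`. -/
def IsBrownianBridge {Ω : Type*} [MeasurableSpace Ω] (P : Measure Ω) (a b x y : ℝ)
    (B : Ω → ℝ → ℝ) : Prop :=
  IsStdBridgeOn P (b - a) (fun ω s => B ω (s + a) - (x + s / (b - a) * (y - x)))


lemma lin_comb_gauss {Ω : Type*} [MeasurableSpace Ω] {P : Measure Ω} {X : Ω → ℝ → ℝ}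
    (hX : IsStdBridgeOn P 1 X) {ι : Type*} [Fintype ι] (ts : ι → ℝ)
    (hts : ∀ i, ts i ∈ Set.Icc (0:ℝ) 1) (c : ι → ℝ) :
    Measure.map (fun ω => ∑ i, c i * X ω (ts i)) P =
      gaussianReal 0 (∑ i, ∑ j, c i * c j * bridgeCov 1 (ts i) (ts j)).toNNReal := by
  have e := (Fintype.equivFin ι).symm
  have := hX.2.2.2 _ (fun i => ts (e i)) (fun i => hts _) (fun i => c (e i))
  convert this using 2
  · ext ω
    exact (Equiv.sum_comp e (fun i => c i * X ω (ts i))).symm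
  · congr 1
    rw [← Equiv.sum_comp e]
    refine Finset.sum_congr rfl fun i _ => ?_
    rw [← Equiv.sum_comp e]

lemma bridge_gaussianProcess {Ω : Type*} [MeasurableSpace Ω] {P : Measure Ω}
    [IsProbabilityMeasure P] {X : Ω → ℝ → ℝ}
    (hX : IsStdBridgeOn P 1 X) :
    IsGaussianProcess (fun (s : Set.Icc (0:ℝ) 1) ω => X ω s) P := by
  have hm := hX.2.2.1
  refine ⟨fun I => ⟨⟨fun L => ?_⟩⟩⟩
  have hmeas : Measurable (fun ω => I.restrict (fun (s : Set.Icc (0:ℝ) 1) => X ω s)) := by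
    refine measurable_pi_lambda _ fun i => hm _
  have key := lin_comb_gauss hX (fun i : I => ((i : Set.Icc (0:ℝ) 1) : ℝ)) (fun i => i.1.2)
    (fun i => L (Pi.single i 1))
  have e : (fun ω => ∑ i : I, L (Pi.single i 1) * X ω ((i : Set.Icc (0:ℝ) 1) : ℝ)) =
      L ∘ (fun ω => I.restrict (fun (s : Set.Icc (0:ℝ) 1) => X ω s)) := by
    ext ω
    simp only [Function.comp]
    have h := LinearMap.pi_apply_eq_sum_univ (L : (I → ℝ) →ₗ[ℝ] ℝ)
      (I.restrict (fun (s : Set.Icc (0:ℝ) 1) => X ω s))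
    simp only [ContinuousLinearMap.coe_coe] at h
    rw [h]
    refine Finset.sum_congr rfl fun i _ => ?_
    rw [smul_eq_mul, mul_comm]
    congr 2
    ext j
    simp [Pi.single_apply, eq_comm]
  rw [e] at key
  rw [← Measure.map_map (by fun_prop) hmeas] at key
  set μ := P.map (fun ω => I.restrict (fun (s : Set.Icc (0:ℝ) 1) => X ω s))
  set v := (∑ i : I, ∑ j : I, L (Pi.single i 1) * L (Pi.single j 1) * bridgeCov 1 ((i : Set.Icc (0:ℝ) 1) : ℝ) ((j : Set.Icc (0:ℝ) 1) : ℝ)).toNNReal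
  have hl : HasLaw L (gaussianReal 0 v) μ := ⟨by fun_prop, key⟩
  rw [key, hl.integral_eq, hl.variance_eq]
  simp

lemma bridge_mean {Ω : Type*} [MeasurableSpace Ω] {P : Measure Ω}
    {X : Ω → ℝ → ℝ} (hX : IsStdBridgeOn P 1 X) (s : ℝ) (hs : s ∈ Set.Icc (0:ℝ) 1) :
    ∫ ω, X ω s ∂P = 0 := by
  have hm := hX.2.2.1
  have h1 := lin_comb_gauss hX (fun i : Fin 1 => s) (fun _ => hs) (fun _ => 1)
  simp only [Finset.univ_unique, Finset.sum_singleton, one_mul] at h1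
  have hl : HasLaw (fun ω => X ω s) _ P := ⟨(hm s).aemeasurable, h1⟩
  rw [hl.integral_eq]; simp

lemma bridge_lin_var {Ω : Type*} [MeasurableSpace Ω] {P : Measure Ω}
    {X : Ω → ℝ → ℝ} (hX : IsStdBridgeOn P 1 X) (s t : ℝ) (hs : 0 ≤ s) (hst : s ≤ t) (ht : t ≤ 1)
    (a b : ℝ) : ProbabilityTheory.variance (fun ω => a * X ω s + b * X ω t) P =
      a ^ 2 * (s * (1 - s)) + 2 * a * b * (s * (1 - t)) + b ^ 2 * (t * (1 - t)) := by
  have hm := hX.2.2.1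
  have h1 := lin_comb_gauss hX ![s, t]
    (by intro i; fin_cases i <;> simp <;> constructor <;> linarith) ![a, b]
  simp only [Fin.sum_univ_two, Matrix.cons_val_zero, Matrix.cons_val_one] at h1
  have hl : HasLaw (fun ω => a * X ω s + b * X ω t) _ P :=
    ⟨(((hm s).const_mul a).add ((hm t).const_mul b)).aemeasurable, h1⟩
  rw [hl.variance_eq, variance_id_gaussianReal, Real.coe_toNNReal]
  · simp only [bridgeCov, min_self, max_self, min_eq_left hst, max_eq_right hst,
      min_eq_right hst, max_eq_left hst]
    ring
  · simp only [bridgeCov, min_self, max_self, min_eq_left hst, max_eq_right hst,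
      min_eq_right hst, max_eq_left hst, div_one]
    have h1 : a * a * (s * (1 - s)) + a * b * (s * (1 - t)) +
        (b * a * (s * (1 - t)) + b * b * (t * (1 - t)))
      = s * (1 - t) * (a + b) ^ 2 + a ^ 2 * (s * (t - s)) + b ^ 2 * ((t - s) * (1 - t)) := by
      ring
    rw [h1]
    have h2 : 0 ≤ 1 - t := by linarith
    have h3 : 0 ≤ t - s := by linarith
    positivity

lemma bridge_cov {Ω : Type*} [MeasurableSpace Ω] {P : Measure Ω} [IsProbabilityMeasure P]
    {X : Ω → ℝ → ℝ} (hX : IsStdBridgeOn P 1 X) (s t : ℝ) (hs : 0 ≤ s) (hst : s ≤ t)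
    (ht : t ≤ 1) : ProbabilityTheory.covariance (fun ω => X ω s) (fun ω => X ω t) P =
      s * (1 - t) := by
  have hg := bridge_gaussianProcess hX
  have h1 : MemLp (fun ω => X ω s) 2 P :=
    (hg.hasGaussianLaw_eval ⟨s, hs, hst.trans ht⟩).memLp_two
  have h2 : MemLp (fun ω => X ω t) 2 P :=
    (hg.hasGaussianLaw_eval ⟨t, hs.trans hst, ht⟩).memLp_two
  have v1 := bridge_lin_var hX s t hs hst ht 1 1
  have v2 := bridge_lin_var hX s t hs hst ht 1 0
  have v3 := bridge_lin_var hX s t hs hst ht 0 1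
  simp only [one_mul, zero_mul, add_zero, zero_add] at v1 v2 v3
  rw [variance_fun_add h1 h2, v2, v3] at v1
  linarith

lemma bridge_preBrownian {Ω : Type*} [MeasurableSpace Ω] {P : Measure Ω} [IsProbabilityMeasure P]
    {X : Ω → ℝ → ℝ} (hX : IsStdBridgeOn P 1 X) :
    IsPreBrownianReal (fun (t : ℝ≥0) ω => (1 + (t:ℝ)) * X ω ((t:ℝ) / (1 + t))) P := by
  have hg := bridge_gaussianProcess hX
  have hmem : ∀ t : ℝ≥0, (t:ℝ) / (1 + t) ∈ Set.Icc (0:ℝ) 1 := fun t =>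
    ⟨by positivity, by rw [div_le_one (by positivity)]; linarith⟩
  refine IsGaussianProcess.isPreBrownianReal_of_covariance ?_ (fun t ↦ ?_) (fun s t hst ↦ ?_)
  · exact (hg.comp_right (fun t : ℝ≥0 => (⟨(t:ℝ) / (1 + t), hmem t⟩ : Set.Icc (0:ℝ) 1))).smul
      (fun t : ℝ≥0 => 1 + (t:ℝ))
  · rw [integral_const_mul, bridge_mean hX _ (hmem t), mul_zero]
  · have hst' : (s:ℝ) ≤ t := hst
    have h0 : (0:ℝ) ≤ s := s.2
    rw [covariance_const_mul_left, covariance_const_mul_right,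
      bridge_cov hX _ _ (hmem s).1 _ (hmem t).2]
    · have : (1 + (t:ℝ)) ≠ 0 := by positivity
      have : (1 + (s:ℝ)) ≠ 0 := by positivity
      field_simp
      ring
    · rw [div_le_div_iff₀ (by positivity) (by positivity)]
      nlinarith

lemma gauss_exp {Ω : Type*} [MeasurableSpace Ω] {P : Measure Ω}
    {Y : Ω → ℝ} {v : ℝ≥0} (hY : HasLaw Y (gaussianReal 0 v) P) (a b : ℝ) :
    Integrable (fun ω => Real.exp (a + b * Y ω)) P ∧
    ∫ ω, Real.exp (a + b * Y ω) ∂P = Real.exp (a + v * b ^ 2 / 2) := by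
  have h1 : Integrable (fun ω => Real.exp (b * Y ω)) P := by
    have := integrable_exp_mul_gaussianReal (μ := 0) (v := v) b
    rw [← hY.map_eq] at this
    exact this.comp_aemeasurable hY.aemeasurable
  have h2 := mgf_gaussianReal hY.map_eq b
  simp only [mgf, zero_mul, zero_add] at h2
  simp only [Real.exp_add]
  exact ⟨h1.const_mul _, by rw [integral_const_mul, h2]⟩

/-- Exponential martingale density. -/
def zz (M δ t w : ℝ) : ℝ := Real.exp (-2 * M * (δ + M * t + w))

lemma zz_eq (M δ t w : ℝ) : zz M δ t w = Real.exp ((-2 * M * (δ + M * t)) + (-2 * M) * w) := by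
  unfold zz; congr 1; ring

/-- Survival event along the grid. -/
def surv {Ω : Type*} (M δ : ℝ) (h : ℝ≥0) (W : ℝ≥0 → Ω → ℝ) (n : ℕ) : Set Ω :=
  {ω | ∀ j ≤ n, 0 < δ + M * ((j * h : ℝ≥0) : ℝ) + W (j * h) ω}

/-- Fourth central moment of the ratio. -/
def err (M : ℝ) (h : ℝ≥0) : ℝ :=
  (Real.exp (4 * M ^ 2 * h) - 1) ^ 2 * (Real.exp (4 * M ^ 2 * h) ^ 4 +
    2 * Real.exp (4 * M ^ 2 * h) ^ 3 + 3 * Real.exp (4 * M ^ 2 * h) ^ 2 - 3)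

lemma surv_meas {Ω : Type*} [MeasurableSpace Ω] (M δ : ℝ) (h : ℝ≥0) (W : ℝ≥0 → Ω → ℝ)
    (hW : ∀ t, Measurable (W t)) (n : ℕ) : MeasurableSet (surv M δ h W n) := by
  have : surv M δ h W n =
      ⋂ (j : ℕ) (_ : j ≤ n), {ω | 0 < δ + M * ((j * h : ℝ≥0) : ℝ) + W (j * h) ω} := by
    ext ω; simp [surv]
  rw [this]
  refine MeasurableSet.iInter fun j => MeasurableSet.iInter fun _ => ?_
  exact measurableSet_lt measurable_const ((hW _).const_add _)

lemma mart_step {Ω : Type*} [MeasurableSpace Ω] {P : Measure Ω} [IsProbabilityMeasure P]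
    (M δ : ℝ) (h : ℝ≥0) (W : ℝ≥0 → Ω → ℝ) (hB : IsPreBrownianReal W P)
    (hW : ∀ t, Measurable (W t)) (n : ℕ) :
    ∫ ω, (surv M δ h W n).indicator
      (fun ω => zz M δ ((n + 1 : ℕ) * h : ℝ≥0) (W ((n + 1 : ℕ) * h) ω)) ω ∂P =
    ∫ ω, (surv M δ h W n).indicator (fun ω => zz M δ (n * h : ℝ≥0) (W (n * h) ω)) ω ∂P := by
  have hind := hB.indepFun_shift (n * h)
  -- functional on the past
  let φ : (Set.Iic ((n:ℝ≥0) * h) → ℝ) → ℝ := fun x =>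
    ({x | ∀ j : Fin (n+1), 0 < δ + M * ((j * h : ℝ≥0) : ℝ) +
      x ⟨(j : ℕ) * h, by
        have : ((j : ℕ) : ℝ≥0) ≤ n := by exact_mod_cast Nat.lt_succ_iff.mp j.2
        exact mul_le_mul_left this h⟩} : Set (Set.Iic ((n:ℝ≥0) * h) → ℝ)).indicator
      (fun x => zz M δ (n * h : ℝ≥0) (x ⟨n * h, Set.mem_Iic.mpr le_rfl⟩)) x
  have hφ : Measurable φ := by
    apply Measurable.indicator
    · unfold zz; fun_prop
    · rw [Set.ofPred_forall]
      refine MeasurableSet.iInter fun j => ?_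
      exact measurableSet_lt measurable_const (by fun_prop)
  let ψ : (ℝ≥0 → ℝ) → ℝ := fun x => Real.exp (-2 * M * (M * h) + (-2 * M) * x h)
  have hψ : Measurable ψ := by fun_prop
  have hi := hind.comp hψ hφ
  have e2 : (φ ∘ fun ω (t : Set.Iic ((n:ℝ≥0) * h)) ↦ W t ω) =
      (surv M δ h W n).indicator (fun ω => zz M δ (n * h : ℝ≥0) (W (n * h) ω)) := by
    ext ω
    simp only [Function.comp, φ, Set.indicator, surv, Set.mem_ofPred_eq]
    congr 1
    rw [eq_iff_iff]
    constructor
    · intro H j hj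
      exact H ⟨j, by omega⟩
    · intro H j
      exact H j (by omega)
  have hlaw : HasLaw (fun ω => W (n * h + h) ω - W (n * h) ω) (gaussianReal 0 h) P :=
    (hB.shift (n * h)).hasLaw_eval h
  have e1 : ∫ ω, (ψ ∘ fun ω t ↦ W (n * h + t) ω - W (n * h) ω) ω ∂P = 1 := by
    have := (gauss_exp hlaw (-2 * M * (M * h)) (-2 * M)).2
    simp only [Function.comp, ψ]
    rw [this, Real.exp_eq_one_iff]
    ring
  have := hi.integral_mul_eq_mul_integral
    (by apply Measurable.aestronglyMeasurable
        apply hψ.comp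
        exact measurable_pi_lambda _ fun t => (hW _).sub (hW _))
    (by rw [e2]
        apply Measurable.aestronglyMeasurable
        refine Measurable.indicator ?_ (surv_meas M δ h W hW n)
        unfold zz
        have := hW (n * h)
        fun_prop)
  rw [e1, e2, one_mul] at this
  rw [← this]
  congr 1
  ext ω
  have ht : (((n + 1 : ℕ) : ℝ≥0)) * h = n * h + h := by push_cast; ring
  simp only [Pi.mul_apply, Function.comp, ψ, Set.indicator]
  rw [ht]
  split_ifs
  · unfold zz
    rw [← Real.exp_add]
    congr 1
    push_cast
    ring
  · simp

lemma fourth {Ω : Type*} [MeasurableSpace Ω] {P : Measure Ω} [IsProbabilityMeasure P]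
    {Y : Ω → ℝ} {h : ℝ≥0} (hY : HasLaw Y (gaussianReal 0 h) P) (M : ℝ) :
    Integrable (fun ω => (Real.exp (-2 * M * (M * h) + (-2 * M) * Y ω) - 1) ^ 4) P ∧
    ∫ ω, (Real.exp (-2 * M * (M * h) + (-2 * M) * Y ω) - 1) ^ 4 ∂P = err M h := by
  have hk : ∀ k : ℕ, Integrable (fun ω => Real.exp (-2 * M * (M * h) + (-2 * M) * Y ω) ^ k) P ∧
      ∫ ω, Real.exp (-2 * M * (M * h) + (-2 * M) * Y ω) ^ k ∂P =
        Real.exp (2 * M ^ 2 * h * (k ^ 2 - k)) := by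
    intro k
    have := gauss_exp hY (k * (-2 * M * (M * h))) (k * (-2 * M))
    have e : ∀ ω, Real.exp (-2 * M * (M * h) + (-2 * M) * Y ω) ^ k =
        Real.exp (k * (-2 * M * (M * h)) + k * (-2 * M) * Y ω) := by
      intro ω
      rw [← Real.exp_nat_mul]; congr 1; ring
    simp only [e]
    refine ⟨this.1, this.2.trans ?_⟩
    congr 1; ring
  have e : ∀ ω, (Real.exp (-2 * M * (M * h) + (-2 * M) * Y ω) - 1) ^ 4 =
      Real.exp (-2 * M * (M * h) + (-2 * M) * Y ω) ^ 4
      - 4 * Real.exp (-2 * M * (M * h) + (-2 * M) * Y ω) ^ 3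
      + 6 * Real.exp (-2 * M * (M * h) + (-2 * M) * Y ω) ^ 2
      - 4 * Real.exp (-2 * M * (M * h) + (-2 * M) * Y ω) ^ 1 + 1 := by
    intro ω; ring
  simp only [e]
  have i4 := (hk 4).1
  have i3 := (hk 3).1.const_mul 4
  have i2 := (hk 2).1.const_mul 6
  have i1 := (hk 1).1.const_mul 4
  have j1 : Integrable (fun ω => Real.exp (-2 * M * (M * h) + (-2 * M) * Y ω) ^ 4
      - 4 * Real.exp (-2 * M * (M * h) + (-2 * M) * Y ω) ^ 3) P := i4.sub i3
  have j2 : Integrable (fun ω => Real.exp (-2 * M * (M * h) + (-2 * M) * Y ω) ^ 4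
      - 4 * Real.exp (-2 * M * (M * h) + (-2 * M) * Y ω) ^ 3
      + 6 * Real.exp (-2 * M * (M * h) + (-2 * M) * Y ω) ^ 2) P := j1.add i2
  have j3 : Integrable (fun ω => Real.exp (-2 * M * (M * h) + (-2 * M) * Y ω) ^ 4
      - 4 * Real.exp (-2 * M * (M * h) + (-2 * M) * Y ω) ^ 3
      + 6 * Real.exp (-2 * M * (M * h) + (-2 * M) * Y ω) ^ 2
      - 4 * Real.exp (-2 * M * (M * h) + (-2 * M) * Y ω) ^ 1) P := j2.sub i1
  refine ⟨j3.add (integrable_const _), ?_⟩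
  rw [integral_add j3 (integrable_const _),
    integral_sub j2 i1, integral_add j1 i2, integral_sub i4 i3,
    integral_const_mul, integral_const_mul, integral_const_mul, (hk 4).2, (hk 3).2, (hk 2).2,
    (hk 1).2]
  have q : ∀ k m : ℕ, 2 * ((k:ℝ) ^ 2 - k) / 4 = m → Real.exp (2 * M ^ 2 * h * (k ^ 2 - k)) =
      Real.exp (4 * M ^ 2 * h) ^ m := by
    intro k m hkm
    rw [← Real.exp_nat_mul, ← hkm]; congr 1; ring
  rw [q 4 6 (by norm_num), q 3 3 (by norm_num), q 2 1 (by norm_num), q 1 0 (by norm_num)]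
  unfold err
  simp
  ring

lemma grid_rec {Ω : Type*} [MeasurableSpace Ω] {P : Measure Ω} [IsProbabilityMeasure P]
    (M δ : ℝ) (hM : 0 < M) (hδ : 0 < δ)
    (h : ℝ≥0) (W : ℝ≥0 → Ω → ℝ) (hB : IsPreBrownianReal W P)
    (hW : ∀ t, Measurable (W t)) (hW0 : ∀ ω, W 0 ω = 0) (η : ℝ) (hη : 0 < η) (n : ℕ) :
    Real.exp (-2 * M * δ) ≤ (1 + η) * (1 - P.real (surv M δ h W n)) +
      ∫ ω, (surv M δ h W n).indicator (fun ω => zz M δ (n * h : ℝ≥0) (W (n * h) ω)) ω ∂P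
      + n * (err M h / η ^ 3) := by
  have hZ : ∀ t : ℝ≥0, Integrable (fun ω => zz M δ t (W t ω)) P := fun t => by
    simp only [zz_eq]
    exact (gauss_exp (hB.hasLaw_eval t) _ _).1
  induction n with
  | zero =>
    have : surv M δ h W 0 = Set.univ := by
      ext ω
      simp [surv, hW0, hδ]
    rw [this]
    simp [hW0, zz]
  | succ n ih =>
    refine ih.trans ?_
    rw [← mart_step M δ h W hB hW n]
    have hlaw : HasLaw (fun ω => W (n * h + h) ω - W (n * h) ω) (gaussianReal 0 h) P :=
      (hB.shift (n * h)).hasLaw_eval h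
    obtain ⟨f1, f2⟩ := fourth hlaw M
    have hA := surv_meas M δ h W hW
    have ht : (((n + 1 : ℕ) : ℝ≥0)) * h = n * h + h := by push_cast; ring
    set R : Ω → ℝ := fun ω => Real.exp (-2 * M * (M * h) +
      (-2 * M) * (W (n * h + h) ω - W (n * h) ω)) with hR
    have hsub : surv M δ h W (n+1) ⊆ surv M δ h W n := fun ω H j hj => H j (by omega)
    have key : ∫ ω, (surv M δ h W n).indicator
      (fun ω => zz M δ ((n + 1 : ℕ) * h : ℝ≥0) (W ((n + 1 : ℕ) * h) ω)) ω ∂P ≤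
      ∫ ω, ((surv M δ h W (n+1)).indicator
      (fun ω => zz M δ ((n + 1 : ℕ) * h : ℝ≥0) (W ((n + 1 : ℕ) * h) ω)) ω +
      ((1 + η) * ((surv M δ h W n).indicator (fun _ => (1:ℝ)) ω -
        (surv M δ h W (n+1)).indicator (fun _ => (1:ℝ)) ω)) + (R ω - 1) ^ 4 / η ^ 3) ∂P := by
      apply integral_mono
      · exact (hZ _).indicator (hA n)
      · refine (((hZ _).indicator (hA (n+1))).add (Integrable.const_mul (Integrable.sub ?_ ?_) _)).add (f1.div_const _)
        · exact (integrable_const _).indicator (hA n)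
        · exact (integrable_const _).indicator (hA (n+1))
      intro ω
      have hp : 0 ≤ (R ω - 1) ^ 4 / η ^ 3 := by positivity
      by_cases h1 : ω ∈ surv M δ h W n
      · by_cases h2 : ω ∈ surv M δ h W (n+1)
        · simp only [h1, h2, Set.indicator_of_mem]
          linarith
        · simp only [h1, h2, Set.indicator_of_mem, Set.indicator_of_notMem, not_false_eq_true]
          have h3 := h1 n le_rfl
          have h4 : zz M δ ((n + 1 : ℕ) * h : ℝ≥0) (W ((n + 1 : ℕ) * h) ω) ≤ R ω := by
            rw [ht, hR]
            unfold zz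
            apply Real.exp_le_exp.mpr
            push_cast at h3 ⊢
            nlinarith [mul_pos hM h3]
          have h5 : R ω ≤ 1 + η + (R ω - 1) ^ 4 / η ^ 3 := by
            rcases le_or_gt (R ω - 1) η with h6 | h6
            · linarith
            · have : R ω - 1 ≤ (R ω - 1) ^ 4 / η ^ 3 := by
                rw [le_div_iff₀ (by positivity), pow_succ' _ 3]
                have : η ^ 3 ≤ (R ω - 1) ^ 3 := by gcongr
                exact mul_le_mul_of_nonneg_left this (by linarith)
              linarith
          linarith
      · have h2 : ω ∉ surv M δ h W (n+1) := fun H => h1 (hsub H)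
        simp only [h1, h2, Set.indicator_of_notMem, not_false_eq_true]
        linarith
    rw [integral_add, integral_add, integral_const_mul, integral_sub, integral_div, f2,
      integral_indicator_const _ (hA n), integral_indicator_const _ (hA (n+1))] at key
    · simp only [smul_eq_mul, mul_one] at key
      push_cast at key ⊢
      linarith
    · exact (integrable_const _).indicator (hA n)
    · exact (integrable_const _).indicator (hA (n+1))
    · exact (hZ _).indicator (hA (n+1))
    · refine (Integrable.const_mul (Integrable.sub ?_ ?_) _)
      · exact (integrable_const _).indicator (hA n)
      · exact (integrable_const _).indicator (hA (n+1))
    · refine (((hZ _).indicator (hA (n+1))).add (Integrable.const_mul (Integrable.sub ?_ ?_) _))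
      · exact (integrable_const _).indicator (hA n)
      · exact (integrable_const _).indicator (hA (n+1))
    · exact f1.div_const _

lemma grid_fin {Ω : Type*} [MeasurableSpace Ω] {P : Measure Ω} [IsProbabilityMeasure P]
    (M δ : ℝ) (hM : 0 < M) (hδ : 0 < δ)
    (h : ℝ≥0) (W : ℝ≥0 → Ω → ℝ) (hB : IsPreBrownianReal W P)
    (hW : ∀ t, Measurable (W t)) (hW0 : ∀ ω, W 0 ω = 0) (η : ℝ) (hη : 0 < η) (n : ℕ) :
    Real.exp (-2 * M * δ) ≤ (1 + η) * (1 - P.real (surv M δ h W n)) +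
      Real.exp (- (M ^ 2 * (n * h)) / 2) + n * (err M h / η ^ 3) := by
  refine (grid_rec M δ hM hδ h W hB hW hW0 η hη n).trans ?_
  gcongr
  have hl := hB.hasLaw_eval (n * h)
  obtain ⟨g1, g2⟩ := gauss_exp hl (-M * (δ + M * (n * h : ℝ≥0))) (-M)
  have hZ : Integrable (fun ω => zz M δ (n * h : ℝ≥0) (W (n * h) ω)) P := by
    simp only [zz_eq]
    exact (gauss_exp hl _ _).1
  calc _ ≤ ∫ ω, Real.exp (-M * (δ + M * (n * h : ℝ≥0)) + (-M) * W (n * h) ω) ∂P := by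
        apply integral_mono (hZ.indicator (surv_meas M δ h W hW n)) g1
        intro ω
        by_cases h1 : ω ∈ surv M δ h W n
        · simp only [h1, Set.indicator_of_mem]
          have h3 := h1 n le_rfl
          unfold zz
          apply Real.exp_le_exp.mpr
          nlinarith [mul_pos hM h3]
        · simp only [h1, Set.indicator_of_notMem, not_false_eq_true]
          positivity
    _ ≤ _ := by
        rw [g2]
        apply Real.exp_le_exp.mpr
        push_cast
        nlinarith [mul_pos hM hδ]

lemma err_le (M : ℝ) (h : ℝ≥0) (hx : 4 * M ^ 2 * h ≤ 1) :
    err M h ≤ 162 * (2 * (4 * M ^ 2 * h)) ^ 2 := by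
  have h0 : 0 ≤ 4 * M ^ 2 * (h:ℝ) := by positivity
  unfold err
  set x := 4 * M ^ 2 * (h:ℝ)
  have h1 : Real.exp x - 1 ≤ 2 * x := by
    have := Real.abs_exp_sub_one_le (x := x) (by rw [abs_of_nonneg h0]; exact hx)
    rw [abs_of_nonneg h0] at this
    exact (le_abs_self _).trans this
  have h2 : 1 ≤ Real.exp x := Real.one_le_exp h0
  have h3 : Real.exp x ≤ 3 := by linarith
  have h4 : (Real.exp x - 1) ^ 2 ≤ (2 * x) ^ 2 := by
    apply pow_le_pow_left₀ (by linarith) h1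
  have a4 : Real.exp x ^ 4 ≤ 3 ^ 4 := by gcongr
  have a3 : Real.exp x ^ 3 ≤ 3 ^ 3 := by gcongr
  have a2 : Real.exp x ^ 2 ≤ 3 ^ 2 := by gcongr
  have h5 : Real.exp x ^ 4 + 2 * Real.exp x ^ 3 + 3 * Real.exp x ^ 2 - 3 ≤ 162 := by
    norm_num at a4 a3 a2; linarith
  calc _ ≤ (Real.exp x - 1) ^ 2 * 162 := by gcongr
    _ ≤ (2 * x) ^ 2 * 162 := by gcongr
    _ = _ := by ring

lemma surv_bound {Ω : Type*} [MeasurableSpace Ω] {P : Measure Ω} [IsProbabilityMeasure P]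
    (M δ : ℝ) (hM : 0 < M) (hδ : 0 < δ)
    (W : ℝ≥0 → Ω → ℝ) (hB : IsPreBrownianReal W P)
    (hW : ∀ t, Measurable (W t)) (hW0 : ∀ ω, W 0 ω = 0) (p : ℝ)
    (hp : ∀ h n, p ≤ P.real (surv M δ h W n)) (hp0 : 0 ≤ p) :
    p ≤ 1 - Real.exp (-2 * M * δ) := by
  have main : ∀ η : ℝ, 0 < η → Real.exp (-2 * M * δ) ≤ (1 + η) * (1 - p) := by
    intro η hη
    have hev : ∀ᶠ m : ℕ in Filter.atTop, Real.exp (-2 * M * δ) ≤ (1 + η) * (1 - p) +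
        Real.exp (-((M ^ 2 / 2) * (m:ℝ))) + (162 * (8 * M ^ 2) ^ 2 / η ^ 3) * (1 / (m:ℝ)) := by
      obtain ⟨m0, hm0⟩ := exists_nat_ge (4 * M ^ 2)
      filter_upwards [Filter.eventually_ge_atTop (max m0 1)] with m hm
      have hm1 : (1:ℝ) ≤ m := by exact_mod_cast (le_max_right _ _).trans hm
      have hm2 : 4 * M ^ 2 ≤ (m:ℝ) := hm0.trans (by exact_mod_cast (le_max_left _ _).trans hm)
      have hmp : (0:ℝ) < m := by linarith
      set h : ℝ≥0 := 1 / (m:ℝ≥0) ^ 2 with hh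
      have hhr : (h:ℝ) = 1 / (m:ℝ) ^ 2 := by rw [hh]; push_cast; rfl
      refine (grid_fin M δ hM hδ h W hB hW hW0 η hη (m ^ 3)).trans ?_
      have e1 : 4 * M ^ 2 * (h:ℝ) ≤ 1 := by
        rw [hhr, mul_one_div, div_le_one (by positivity)]
        nlinarith
      have e2 := err_le M h e1
      have t1 : (1 + η) * (1 - P.real (surv M δ h W (m ^ 3))) ≤ (1 + η) * (1 - p) := by
        have := hp h (m ^ 3)
        gcongr
      have t2 : Real.exp (- (M ^ 2 * ((m ^ 3 : ℕ) * h)) / 2) =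
          Real.exp (-((M ^ 2 / 2) * (m:ℝ))) := by
        congr 1
        rw [hhr]; push_cast; field_simp
      have t3 : ((m ^ 3 : ℕ) : ℝ) * (err M h / η ^ 3) ≤
          (162 * (8 * M ^ 2) ^ 2 / η ^ 3) * (1 / (m:ℝ)) := by
        calc _ ≤ ((m ^ 3 : ℕ) : ℝ) * (162 * (2 * (4 * M ^ 2 * h)) ^ 2 / η ^ 3) := by gcongr
          _ = _ := by rw [hhr]; push_cast; field_simp; ring
      linarith
    have hlim : Filter.Tendsto (fun m : ℕ => (1 + η) * (1 - p) +
        Real.exp (-((M ^ 2 / 2) * (m:ℝ))) + (162 * (8 * M ^ 2) ^ 2 / η ^ 3) * (1 / (m:ℝ)))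
        Filter.atTop (nhds ((1 + η) * (1 - p) + 0 + (162 * (8 * M ^ 2) ^ 2 / η ^ 3) * 0)) := by
      refine (tendsto_const_nhds.add ?_).add (tendsto_one_div_atTop_nhds_zero_nat.const_mul _)
      refine Real.tendsto_exp_neg_atTop_nhds_zero.comp ?_
      exact Filter.Tendsto.const_mul_atTop (by positivity) tendsto_natCast_atTop_atTop
    have := ge_of_tendsto hlim hev
    linarith
  have : Real.exp (-2 * M * δ) ≤ 1 - p := by
    refine le_of_forall_pos_le_add fun η hη => ?_
    have := main η hη
    nlinarith
  linarith

/-- Let `M, δ > 0` and let `B` be a Brownian bridge on `[0,1]` from `B 0 = δ` to `B 1 = M`.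
Then `P (B s > 0 for all s ∈ [0,1]) ≤ 4 √(2/π) √(δ M)`. -/
theorem bridge_positivity_probability_bound
    {Ω : Type*} [MeasurableSpace Ω] (P : Measure Ω) (hP : IsProbabilityMeasure P)
    (M δ : ℝ) (hM : 0 < M) (hδ : 0 < δ)
    (B : Ω → ℝ → ℝ) (hB : IsBrownianBridge P 0 1 δ M B) :
    P {ω | ∀ s ∈ Set.Icc (0:ℝ) 1, 0 < B ω s} ≤
      ENNReal.ofReal (4 * Real.sqrt (2 / Real.pi) * Real.sqrt (δ * M)) := by
  have hX : IsStdBridgeOn P 1 (fun ω s => B ω s - (δ + s * (M - δ))) := by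
    have := hB
    unfold IsBrownianBridge at this
    simpa using this
  have hpre := bridge_preBrownian hX
  set W : ℝ≥0 → Ω → ℝ := fun t ω => (1 + (t:ℝ)) *
    (B ω ((t:ℝ) / (1 + t)) - (δ + ((t:ℝ) / (1 + t)) * (M - δ))) with hWdef
  have hW : ∀ t, Measurable (W t) := fun t => (hX.2.2.1 _).const_mul _
  have hW0 : ∀ ω, W 0 ω = 0 := fun ω => by
    have : B ω 0 - (δ + 0 * (M - δ)) = 0 := (hX.2.1 ω).1
    simp only [hWdef, NNReal.coe_zero, zero_div]
    rw [this, mul_zero]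
  have hsub : ∀ h n, {ω | ∀ s ∈ Set.Icc (0:ℝ) 1, 0 < B ω s} ⊆ surv M δ h W n := by
    intro h n ω H j hj
    set t : ℝ≥0 := j * h
    have h1 : (0:ℝ) < 1 + t := by positivity
    have h2 := H ((t:ℝ) / (1 + t)) ⟨by positivity, by rw [div_le_one h1]; linarith⟩
    have : δ + M * (t:ℝ) + W t ω = (1 + (t:ℝ)) * B ω ((t:ℝ) / (1 + t)) := by
      simp only [hWdef]
      field_simp
      ring
    rw [this]
    positivity
  have hb := surv_bound M δ hM hδ W hpre hW hW0 (P.real {ω | ∀ s ∈ Set.Icc (0:ℝ) 1, 0 < B ω s})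
    (fun h n => measureReal_mono (hsub h n)) measureReal_nonneg
  rw [← ofReal_measureReal]
  apply ENNReal.ofReal_le_ofReal
  refine hb.trans ?_
  have hq : 0 < δ * M := mul_pos hδ hM
  have h2 : 1 / 2 ≤ Real.sqrt (2 / Real.pi) := by
    apply Real.le_sqrt_of_sq_le
    rw [le_div_iff₀ Real.pi_pos]
    linarith [Real.pi_le_four]
  have h3 : 0 < Real.sqrt (δ * M) := Real.sqrt_pos.mpr hq
  have h4 : Real.sqrt (δ * M) ^ 2 = δ * M := Real.sq_sqrt hq.le
  have h5 : 1 - Real.exp (-2 * M * δ) ≤ 2 * Real.sqrt (δ * M) := by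
    rcases le_or_gt 1 (Real.sqrt (δ * M)) with h6 | h6
    · linarith [Real.exp_pos (-2 * M * δ)]
    · have := Real.add_one_le_exp (-2 * M * δ)
      nlinarith
  nlinarith
end
end
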